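/- Let A ⊆ B be an extension of commutative rings, let ⁺A denote the subintegral closure of A in B, and let M be a positive commutative cancellative torsion-free monoid. Then the subintegral closure of A[M] in B[M] equals (⁺A)[M]. -/

import Mathlib

open scoped Classical

noncomputable section

/-- `A` is subintegrally closed in its ambient ring `B`:
every `b : B` with `b² ∈ A` and `b³ ∈ A` lies in `A`. -/
def Subring.IsSubintegrallyClosedIn {B : Type*} [CommRing B] (A : Subring B) : Prop :=
  ∀ b : B, b ^ 2 ∈ A → b ^ 3 ∈ A → b ∈ A

/-- `M` is subintegrally closed in its ambient monoid `N`: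
every `x : N` with `x² ∈ M` and `x³ ∈ M` lies in `M`. -/
def Submonoid.IsSubintegrallyClosedIn {N : Type*} [CommMonoid N] (M : Submonoid N) : Prop :=
  ∀ x : N, x ^ 2 ∈ M → x ^ 3 ∈ M → x ∈ M

/-- A commutative monoid is torsion-free. -/
def MulTorsionFree (N : Type*) [CommMonoid N] : Prop :=
  ∀ (x y : N) (n : ℕ), n ≠ 0 → x ^ n = y ^ n → x = y

/-- A commutative monoid is positive if its only unit is the identity. -/
def IsPositiveMonoid (N : Type*) [CommMonoid N] : Prop :=
  ∀ x : N, IsUnit x → x = 1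

/-- The subring `A[M]` of the monoid algebra `B[N]`, for a subring `A ⊆ B` and a submonoid
`M ⊆ N`: the subring generated by the elements `a·m` (`a ∈ A`, `m ∈ M`); equivalently, the set
of elements of `B[N]` supported on `M` with all coefficients in `A`. -/
def monoidAlgebraSubring {B : Type*} [CommRing B] {N : Type*} [CommMonoid N]
    (A : Subring B) (M : Submonoid N) : Subring (MonoidAlgebra B N) :=
  Subring.closure {x | ∃ a ∈ A, ∃ m ∈ M, x = MonoidAlgebra.single m a}

/-- The subintegral closure of `A` in an intermediate ring `C` (for `A ⊆ C ⊆ B`): the smallest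
subring `T` of `B` containing `A` such that every `b ∈ C` with `b² ∈ T` and `b³ ∈ T` lies in
`T`. -/
def Subring.subintegralClosureIn {B : Type*} [CommRing B] (A C : Subring B) : Subring B :=
  sInf {T : Subring B | A ≤ T ∧ ∀ b ∈ C, b ^ 2 ∈ T → b ^ 3 ∈ T → b ∈ T}

/-- The subintegral closure `⁺A` of `A` in `B`: the smallest subring `T` of `B` containing `A`
such that every `b : B` with `b² ∈ T` and `b³ ∈ T` lies in `T`. -/
def Subring.subintegralClosure {B : Type*} [CommRing B] (A : Subring B) : Subring B :=
  A.subintegralClosureIn ⊤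

/-- The subintegral closure of `M` in an intermediate monoid `C` (for `M ⊆ C ⊆ G`): the
smallest submonoid `T` of `G` containing `M` such that every `x ∈ C` with `x² ∈ T` and
`x³ ∈ T` lies in `T`. -/
def Submonoid.subintegralClosureIn {G : Type*} [CommMonoid G] (M C : Submonoid G) : Submonoid G :=
  sInf {T : Submonoid G | M ≤ T ∧ ∀ x ∈ C, x ^ 2 ∈ T → x ^ 3 ∈ T → x ∈ T}

section SubintegralClosure

variable {B : Type*} [CommRing B]

lemma Subring.le_subintegralClosure (A : Subring B) : A ≤ A.subintegralClosure :=
  le_sInf fun _ hT => hT.1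

lemma Subring.isSubintegrallyClosedIn_subintegralClosure (A : Subring B) :
    A.subintegralClosure.IsSubintegrallyClosedIn := by
  intro b h2 h3
  refine Subring.mem_sInf.2 fun T hT => hT.2 b trivial ?_ ?_
  · exact Subring.mem_sInf.1 h2 T hT
  · exact Subring.mem_sInf.1 h3 T hT

lemma Subring.subintegralClosure_le {A T : Subring B} (hA : A ≤ T)
    (hT : T.IsSubintegrallyClosedIn) : A.subintegralClosure ≤ T :=
  sInf_le ⟨hA, fun b _ => hT b⟩

lemma Subring.IsSubintegrallyClosedIn.comap {B' : Type*} [CommRing B'] {T : Subring B'}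
    (hT : T.IsSubintegrallyClosedIn) (φ : B →+* B') :
    (T.comap φ).IsSubintegrallyClosedIn := fun b h2 h3 =>
  hT (φ b) (by simpa using h2) (by simpa using h3)

/-- If some power of `d` is a common denominator for all powers of `b`, then `d * b` lies in every
subintegrally closed subring containing `d`. -/
lemma Subring.IsSubintegrallyClosedIn.mul_mem_of_forall_pow {C : Subring B}
    (hC : C.IsSubintegrallyClosedIn) {d b : B} (hd : d ∈ C)
    (h : ∃ N, ∀ k, d ^ N * b ^ k ∈ C) : d * b ∈ C := by
  obtain ⟨N, hN⟩ := h
  have large : ∀ k, N ≤ k → (d * b) ^ k ∈ C := by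
    intro k hk
    obtain ⟨j, rfl⟩ := Nat.exists_eq_add_of_le hk
    have := C.mul_mem (C.pow_mem hd j) (hN (N + j))
    convert this using 1
    ring
  have descend : ∀ j k, 1 ≤ k → N ≤ k + j → (d * b) ^ k ∈ C := by
    intro j
    induction j with
    | zero => exact fun k _ hk => large k hk
    | succ j ih =>
      intro k hk hkj
      apply hC
      · rw [← pow_mul]
        exact ih _ (by omega) (by omega)
      · rw [← pow_mul]
        exact ih _ (by omega) (by omega)
  simpa using descend N 1 le_rfl (by omega)

/-- Elements whose powers have a power of `d` as common denominator are closed under addition. -/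
lemma Subring.exists_pow_mul_add_pow_mem {C : Subring B} {d x y : B}
    (hx : ∃ N, ∀ k, d ^ N * x ^ k ∈ C) (hy : ∃ N, ∀ k, d ^ N * y ^ k ∈ C) :
    ∃ N, ∀ k, d ^ N * (x + y) ^ k ∈ C := by
  obtain ⟨N, hN⟩ := hx
  obtain ⟨N', hN'⟩ := hy
  refine ⟨N + N', fun k => ?_⟩
  rw [add_pow, Finset.mul_sum]
  refine C.sum_mem fun j _ => ?_
  have := C.mul_mem (C.mul_mem (hN j) (hN' (k - j))) (natCast_mem C (k.choose j))
  convert this using 1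
  ring

end SubintegralClosure

section Coefficients

variable {B : Type*} [CommRing B] {M : Type*} [CommMonoid M]

lemma single_mem_monoidAlgebraSubring {C : Subring B} {b : B} (hb : b ∈ C) (m : M) :
    MonoidAlgebra.single m b ∈ monoidAlgebraSubring C (⊤ : Submonoid M) :=
  Subring.subset_closure ⟨b, hb, m, trivial, rfl⟩

lemma mem_monoidAlgebraSubring_top {C : Subring B} {f : MonoidAlgebra B M} :
    f ∈ monoidAlgebraSubring C (⊤ : Submonoid M) ↔ ∀ m, f.coeff m ∈ C := by
  constructor
  · intro hf
    induction hf using Subring.closure_induction with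
    | mem x hx =>
      obtain ⟨a, ha, m, -, rfl⟩ := hx
      intro n
      rw [MonoidAlgebra.coeff_single, Finsupp.single_apply]
      split_ifs
      exacts [ha, C.zero_mem]
    | zero => intro m; simp
    | one =>
      intro m
      rw [MonoidAlgebra.one_def, MonoidAlgebra.coeff_single, Finsupp.single_apply]
      split_ifs
      exacts [C.one_mem, C.zero_mem]
    | add x y _ _ hx hy =>
      intro m
      simpa using C.add_mem (hx m) (hy m)
    | neg x _ hx =>
      intro m
      simpa using hx m
    | mul x y _ _ hx hy =>
      intro m
      rw [MonoidAlgebra.coeff_mul]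
      refine C.sum_mem fun a _ => C.sum_mem fun b _ => ?_
      dsimp only
      split_ifs
      exacts [C.mul_mem (hx a) (hy b), C.zero_mem]
  · intro hf
    rw [← MonoidAlgebra.sum_coeff_single f]
    exact Subring.sum_mem _ fun m _ => single_mem_monoidAlgebraSubring (hf m) m

lemma single_mul_mem_monoidAlgebraSubring {C : Subring B} {b : B} {f : MonoidAlgebra B M}
    (h : ∀ m, b * f.coeff m ∈ C) (m : M) :
    MonoidAlgebra.single m b * f ∈ monoidAlgebraSubring C (⊤ : Submonoid M) := by
  have hbf : b • f ∈ monoidAlgebraSubring C (⊤ : Submonoid M) :=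
    mem_monoidAlgebraSubring_top.2 fun n => by simpa using h n
  have := Subring.mul_mem _ (single_mem_monoidAlgebraSubring C.one_mem m) hbf
  rwa [mul_smul_comm, ← smul_mul_assoc, MonoidAlgebra.smul_single, smul_eq_mul, mul_one] at this

end Coefficients

open MonoidAlgebra in
/-- Induction on elements of a monoid algebra, removing the term of lowest degree. -/
lemma MonoidAlgebra.induction_erase_lowest {B M : Type*} [Semiring B] [LinearOrder M]
    {P : MonoidAlgebra B M → Prop} (zero : P 0)
    (step : ∀ (f : MonoidAlgebra B M) (m : M), (∀ a ∈ f.coeff.support, m ≤ a) →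
      (∀ f' : MonoidAlgebra B M, f'.coeff.support ⊆ (f.erase m).coeff.support → P f') → P f)
    (f : MonoidAlgebra B M) : P f := by
  induction hn : f.coeff.support.card using Nat.strong_induction_on generalizing f with
  | _ n ih =>
    by_cases hf : f = 0
    · exact hf ▸ zero
    · have hs : f.coeff.support.Nonempty := by
        rw [Finsupp.support_nonempty_iff]
        exact fun h => hf (coeff_eq_zero.1 h)
      refine step f (f.coeff.support.min' hs) (fun a ha => Finset.min'_le _ a ha)
        fun f' hf' => ih _ ?_ f' rfl
      rw [← hn]
      refine (Finset.card_le_card hf').trans_lt ?_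
      rw [coeff_erase, Finsupp.support_erase]
      convert Finset.card_erase_lt_of_mem (Finset.min'_mem _ hs)

section Ordered

open MonoidAlgebra

variable {B : Type*} [CommRing B] {M : Type*} [CommMonoid M] [LinearOrder M]
  [IsOrderedCancelMonoid M]

lemma MonoidAlgebra.coeff_mul_of_forall_le {f g : MonoidAlgebra B M} {m n : M}
    (hf : ∀ a ∈ f.coeff.support, m ≤ a) (hg : ∀ b ∈ g.coeff.support, n ≤ b) :
    (f * g).coeff (m * n) = f.coeff m * g.coeff n := by
  apply MonoidAlgebra.coeff_mul_mul_of_uniqueMul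
  intro a b ha hb hab
  have := (mul_eq_mul_iff_eq_and_eq (hf a ha) (hg b hb)).1 hab.symm
  exact ⟨this.1.symm, this.2.symm⟩

lemma MonoidAlgebra.le_of_mem_support_mul {f g : MonoidAlgebra B M} {m n : M}
    (hf : ∀ a ∈ f.coeff.support, m ≤ a) (hg : ∀ b ∈ g.coeff.support, n ≤ b) :
    ∀ c ∈ (f * g).coeff.support, m * n ≤ c := by
  intro c hc
  obtain ⟨a, ha, b, hb, rfl⟩ := Finset.mem_mul.1 (support_coeff_mul_subset f g hc)
  exact mul_le_mul' (hf a ha) (hg b hb)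

lemma MonoidAlgebra.le_of_mem_support_pow {f : MonoidAlgebra B M} {m : M}
    (hf : ∀ a ∈ f.coeff.support, m ≤ a) (k : ℕ) :
    ∀ c ∈ (f ^ k).coeff.support, m ^ k ≤ c := by
  induction k with
  | zero =>
    intro c hc
    rw [pow_zero, one_def, coeff_single] at hc
    have := Finsupp.support_single_subset hc
    simp_all
  | succ k ih =>
    rw [pow_succ, pow_succ]
    exact le_of_mem_support_mul ih hf

lemma MonoidAlgebra.coeff_pow_of_forall_le {f : MonoidAlgebra B M} {m : M}
    (hf : ∀ a ∈ f.coeff.support, m ≤ a) (k : ℕ) :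
    (f ^ k).coeff (m ^ k) = f.coeff m ^ k := by
  induction k with
  | zero => simp
  | succ k ih =>
    rw [pow_succ, pow_succ, coeff_mul_of_forall_le (le_of_mem_support_pow hf k) hf, ih, pow_succ]

/-- If `g` and `f * g` have coefficients in `C`, then some power of the lowest coefficient of `g`
is a common denominator for the coefficients of `f`. -/
lemma exists_pow_mul_coeff_mem {C : Subring B} {g : MonoidAlgebra B M} {n : M}
    (hg : g ∈ monoidAlgebraSubring C (⊤ : Submonoid M)) (hn : ∀ b ∈ g.coeff.support, n ≤ b)
    (f : MonoidAlgebra B M) (hfg : f * g ∈ monoidAlgebraSubring C (⊤ : Submonoid M)) :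
    ∃ N, ∀ m, g.coeff n ^ N * f.coeff m ∈ C := by
  induction f using MonoidAlgebra.induction_erase_lowest with
  | zero => exact ⟨0, fun m => by simp⟩
  | step f m₀ hm₀ ih =>
    set d := g.coeff n
    have hd : d ∈ C := mem_monoidAlgebraSubring_top.1 hg n
    have hb : d * f.coeff m₀ ∈ C := by
      rw [mul_comm, ← coeff_mul_of_forall_le hm₀ hn]
      exact mem_monoidAlgebraSubring_top.1 hfg _
    have herase : (d • f.erase m₀) * g = d • (f * g) - single m₀ (d * f.coeff m₀) * g := by
      rw [← smul_eq_mul d, ← smul_single, smul_mul_assoc, smul_mul_assoc, ← smul_sub, ← sub_mul,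
        sub_eq_of_eq_add (erase_add_single m₀ f).symm]
    obtain ⟨N, hN⟩ := ih (d • f.erase m₀) (by
      rw [coeff_smul]; exact Finsupp.support_smul) (by
      rw [herase]
      refine Subring.sub_mem _ (mem_monoidAlgebraSubring_top.2 fun m => ?_)
        (Subring.mul_mem _ (single_mem_monoidAlgebraSubring hb m₀) hg)
      simpa using C.mul_mem hd (mem_monoidAlgebraSubring_top.1 hfg m))
    refine ⟨N + 1, fun m => ?_⟩
    rw [pow_succ, mul_assoc]
    by_cases hm : m = m₀
    · rw [hm]
      exact C.mul_mem (C.pow_mem hd N) hb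
    · simpa [hm] using hN m

/-- If some power of `d` is a common denominator for all powers of `f`, then the same holds for
each coefficient of `f`. -/
lemma exists_pow_mul_coeff_pow_mem {C : Subring B} {d : B} (f : MonoidAlgebra B M)
    (hf : ∃ N, ∀ k, (single 1 d : MonoidAlgebra B M) ^ N * f ^ k ∈
      monoidAlgebraSubring C (⊤ : Submonoid M)) (m : M) :
    ∃ N, ∀ k, d ^ N * f.coeff m ^ k ∈ C := by
  induction f using MonoidAlgebra.induction_erase_lowest with
  | zero =>
    obtain ⟨N, hN⟩ := hf
    refine ⟨N, fun k => ?_⟩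
    have := mem_monoidAlgebraSubring_top.1 (hN k) 1
    cases k <;> simp_all [single_pow]
  | step f m₀ hm₀ ih =>
    have hb : ∃ N, ∀ k, d ^ N * f.coeff m₀ ^ k ∈ C := by
      obtain ⟨N, hN⟩ := hf
      refine ⟨N, fun k => ?_⟩
      have := mem_monoidAlgebraSubring_top.1 (hN k) (m₀ ^ k)
      rwa [single_pow, one_pow, coeff_single_one_mul, coeff_pow_of_forall_le hm₀] at this
    by_cases hm : m = m₀
    · rwa [hm]
    have hs : ∃ N, ∀ k, (single 1 d : MonoidAlgebra B M) ^ N * single m₀ (-f.coeff m₀) ^ k ∈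
        monoidAlgebraSubring C (⊤ : Submonoid M) := by
      obtain ⟨N, hN⟩ := hb
      refine ⟨N, fun k => ?_⟩
      rw [single_pow, single_pow, single_mul_single]
      refine single_mem_monoidAlgebraSubring ?_ _
      rw [neg_pow, mul_left_comm]
      exact C.mul_mem (C.pow_mem (C.neg_mem C.one_mem) k) (hN k)
    have := ih (f.erase m₀) subset_rfl (by
      have := Subring.exists_pow_mul_add_pow_mem hf hs
      rwa [single_neg, ← sub_eq_add_neg, sub_eq_of_eq_add (erase_add_single m₀ f).symm] at this)
    simpa [hm] using this

theorem Subring.IsSubintegrallyClosedIn.monoidAlgebraSubring_of_ordered {C : Subring B}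
    (hC : C.IsSubintegrallyClosedIn) :
    (monoidAlgebraSubring C (⊤ : Submonoid M)).IsSubintegrallyClosedIn := by
  intro f
  induction f using MonoidAlgebra.induction_erase_lowest with
  | zero => exact fun _ _ => Subring.zero_mem _
  | step f m₀ hm₀ ih =>
    intro h2 h3
    set b := f.coeff m₀
    have hb : b ∈ C := by
      apply hC
      · rw [← coeff_pow_of_forall_le hm₀]
        exact mem_monoidAlgebraSubring_top.1 h2 _
      · rw [← coeff_pow_of_forall_le hm₀]
        exact mem_monoidAlgebraSubring_top.1 h3 _
    have hpow : ∀ k, f ^ (k + 2) ∈ monoidAlgebraSubring C (⊤ : Submonoid M) := by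
      intro k
      induction k using Nat.twoStepInduction with
      | zero => exact h2
      | one => exact h3
      | more k ih₁ _ =>
        rw [show k + 2 + 2 = (k + 2) + 2 from rfl, pow_add]
        exact Subring.mul_mem _ ih₁ h2
    have hden : ∃ N, ∀ k, (single 1 b : MonoidAlgebra B M) ^ N * f ^ k ∈
        monoidAlgebraSubring C (⊤ : Submonoid M) := by
      obtain ⟨N, hN⟩ := exists_pow_mul_coeff_mem h2 (le_of_mem_support_pow hm₀ 2) f
        (by rwa [← pow_succ'])
      rw [coeff_pow_of_forall_le hm₀, ← pow_mul] at hN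
      refine ⟨2 * N, fun k => ?_⟩
      have hs : (single 1 b : MonoidAlgebra B M) ^ (2 * N) ∈
          monoidAlgebraSubring C (⊤ : Submonoid M) :=
        Subring.pow_mem _ (single_mem_monoidAlgebraSubring hb 1) _
      match k with
      | 0 => simpa using hs
      | 1 =>
        rw [pow_one, single_pow, one_pow]
        exact single_mul_mem_monoidAlgebraSubring hN 1
      | k + 2 => exact Subring.mul_mem _ hs (hpow k)
    have hs : single m₀ b ∈ monoidAlgebraSubring C (⊤ : Submonoid M) :=
      single_mem_monoidAlgebraSubring hb m₀
    have hsf : single m₀ b * f ∈ monoidAlgebraSubring C (⊤ : Submonoid M) :=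
      single_mul_mem_monoidAlgebraSubring
        (fun m => hC.mul_mem_of_forall_pow hb (exists_pow_mul_coeff_pow_mem f hden m)) m₀
    have herase : f.erase m₀ = f - single m₀ b :=
      (sub_eq_of_eq_add (erase_add_single m₀ f).symm).symm
    rw [← erase_add_single m₀ f]
    refine Subring.add_mem _ (ih _ subset_rfl ?_ ?_) hs
    · rw [herase, show (f - single m₀ b) ^ 2 =
        f ^ 2 - (single m₀ b * f + single m₀ b * f) + single m₀ b * single m₀ b by ring]
      exact Subring.add_mem _ (Subring.sub_mem _ h2 (Subring.add_mem _ hsf hsf))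
        (Subring.mul_mem _ hs hs)
    · rw [herase, show (f - single m₀ b) ^ 3 = f ^ 3 - (3 : ℕ) • (single m₀ b * f ^ 2) +
        (3 : ℕ) • (single m₀ b * (single m₀ b * f)) - single m₀ b ^ 3 by
          simp only [nsmul_eq_mul]; push_cast; ring]
      exact Subring.sub_mem _ (Subring.add_mem _ (Subring.sub_mem _ h3
        (nsmul_mem (Subring.mul_mem _ hs h2) 3))
        (nsmul_mem (Subring.mul_mem _ hs hsf) 3)) (Subring.pow_mem _ hs 3)

end Ordered

section ExistsOrder

open scoped TensorProduct

/-- A torsion-free abelian group embeds in a rational vector space. -/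
lemma exists_injective_addMonoidHom_finsupp_rat.{u} (G : Type u) [AddCommGroup G]
    [IsAddTorsionFree G] :
    ∃ (ι : Type u) (φ : G →+ (ι →₀ ℚ)), Function.Injective φ := by
  let j : G →ₗ[ℤ] ℚ ⊗[ℤ] G := TensorProduct.mk ℤ ℚ G 1
  have hj : Function.Injective j := by
    have h := Module.Flat.rTensor_preserves_injective_linearMap (M := G)
      (Algebra.linearMap ℤ ℚ) (by exact Int.cast_injective)
    have : (j : G → ℚ ⊗[ℤ] G) =
        (LinearMap.rTensor G (Algebra.linearMap ℤ ℚ)) ∘ (TensorProduct.lid ℤ G).symm := by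
      ext x; simp [j]; rfl
    rw [this]
    exact h.comp (LinearEquiv.injective _)
  let e := (Module.Basis.ofVectorSpace ℚ (ℚ ⊗[ℤ] G)).repr
  exact ⟨_, e.toAddEquiv.toAddMonoidHom.comp j.toAddMonoidHom, e.injective.comp hj⟩

lemma exists_isOrderedCancelMonoid {M : Type*} [CancelCommMonoid M] (htf : MulTorsionFree M) :
    ∃ _ : LinearOrder M, IsOrderedCancelMonoid M := by
  have : IsMulTorsionFree M := ⟨fun n hn x y h => htf x y n hn h⟩
  obtain ⟨ι, φ, hφ⟩ := exists_injective_addMonoidHom_finsupp_rat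
    (Algebra.GrothendieckAddGroup (Additive M))
  let _ : LinearOrder ι := linearOrderOfSTO WellOrderingRel
  let ψ : M → Lex (ι →₀ ℚ) := fun x => toLex (φ (Algebra.GrothendieckAddGroup.of (.ofMul x)))
  have hψ : Function.Injective ψ := by
    refine toLex.injective.comp (hφ.comp (Function.Injective.comp ?_ Additive.ofMul.injective))
    simpa using! AddLocalization.mk_left_injective 0
  have hmul : ∀ x y, ψ (x * y) = ψ x + ψ y := fun x y => by simp [ψ]
  let _ : LinearOrder M := LinearOrder.lift' ψ hψ
  have hle : ∀ x y, x ≤ y ↔ ψ x ≤ ψ y := fun _ _ => Iff.rfl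
  refine ⟨inferInstance, ?_⟩
  exact
    { mul_le_mul_left := fun a b h c => by
        rw [hle, hmul, hmul]
        gcongr; exact h
      le_of_mul_le_mul_left := fun a b c h => by
        rw [hle, hmul, hmul] at h
        exact (add_le_add_iff_left (ψ a)).1 h }

end ExistsOrder

/-- **Sarwar, Remark 3.4 / Theorem 1.4.**  Let `A ⊆ B` be an extension of commutative rings,
`⁺A` the subintegral closure of `A` in `B`, and `M` a positive commutative cancellative
torsion-free monoid.  Then the subintegral closure of `A[M]` in `B[M]` is `(⁺A)[M]`. -/
theorem subintegralClosure_monoidAlgebra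
    {B : Type*} [CommRing B] (A : Subring B)
    {M : Type*} [CancelCommMonoid M]
    (htf : MulTorsionFree M) (hpos : IsPositiveMonoid M) :
    (monoidAlgebraSubring A (⊤ : Submonoid M)).subintegralClosure =
      monoidAlgebraSubring (A.subintegralClosure) (⊤ : Submonoid M) := by
  obtain ⟨_, _⟩ := exists_isOrderedCancelMonoid htf
  refine le_antisymm (Subring.subintegralClosure_le ?_ ?_) ?_
  · refine Subring.closure_mono ?_
    rintro _ ⟨a, ha, m, hm, rfl⟩
    exact ⟨a, A.le_subintegralClosure ha, m, hm, rfl⟩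
  · exact A.isSubintegrallyClosedIn_subintegralClosure.monoidAlgebraSubring_of_ordered
  · refine Subring.closure_le.2 ?_
    rintro _ ⟨a, ha, m, -, rfl⟩
    have hA : A.subintegralClosure ≤ (monoidAlgebraSubring A
        (⊤ : Submonoid M)).subintegralClosure.comap MonoidAlgebra.singleOneRingHom :=
      Subring.subintegralClosure_le
        (fun x hx => Subring.le_subintegralClosure _ (single_mem_monoidAlgebraSubring hx 1))
        ((Subring.isSubintegrallyClosedIn_subintegralClosure _).comap _)
    have := Subring.mul_mem _ (Subring.le_subintegralClosure _
      (single_mem_monoidAlgebraSubring A.one_mem m)) (hA ha)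
    simpa [MonoidAlgebra.single_mul_single] using this
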